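/- Fix k ≥ 1. Let G = (V,E), P ⊆ V × V and G' = (V',E') be as in the reduction construction (for every v ∈ V a set V_v = {x_{(v,1)},…,x_{(v,(k+1)^2)}} of new vertices joined to v; for every pair {u,v} ∉ P of distinct vertices a set V_{(u,v)} = {x_{(u,v,1)},…,x_{(u,v,(k+1)^2)}} of new vertices joined to both u and v; all new vertices pairwise adjacent). Suppose χ : V ∪ E → {0,1,2} is a total coloring of G making every pair in P total rainbow k-connected. Extend χ to χ' on G' by: χ'(x) = 2 for all x ∈ V' \ V; χ'(v x_{(v,i)}) = 1 for all v ∈ V and x_{(v,i)} ∈ V_v; χ'(u x_{(u,v,i)}) = 0 and χ'(v x_{(u,v,i)}) = 1 for all {u,v} ∉ P and x_{(u,v,i)} ∈ V_{(u,v)}; color the edges inside each clique G'[V_v] and G'[V_{(u,v)}] (each a complete graph on (k+1)^2 vertices, viewed with vertex set {(i,l) : 1 ≤ i,l ≤ k+1}) with color 0 if the endpoints agree in the first or the second coordinate and with color 1 otherwise; and color all remaining uncolored edges 0. Then χ' makes every two distinct vertices of G' total rainbow k-connected. -/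

import Mathlib

open SimpleGraph

namespace Paper

variable {V : Type*}

/-- The internal vertices of a walk (all vertices except the two endpoints). -/
def internalSupport {G : SimpleGraph V} {u v : V} (p : G.Walk u v) : List V :=
  p.support.tail.dropLast

/-- A family of walks between two fixed vertices is internally disjoint if the walks
are pairwise distinct and no two of them share an internal vertex. -/
def InternallyDisjoint {G : SimpleGraph V} {u v : V} {k : ℕ}
    (P : Fin k → G.Walk u v) : Prop :=
  Function.Injective P ∧
    ∀ i j, i ≠ j → ∀ w, w ∈ internalSupport (P i) → w ∉ internalSupport (P j)

/-- A rainbow path for an edge coloring: a path whose edges have pairwise distinct colors. -/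
def IsRainbowPath {α : Type*} {G : SimpleGraph V} (c : Sym2 V → α)
    {u v : V} (p : G.Walk u v) : Prop :=
  p.IsPath ∧ (p.edges.map c).Nodup

/-- A vertex-rainbow path: a path whose internal vertices have pairwise distinct colors. -/
def IsVertexRainbowPath {α : Type*} {G : SimpleGraph V} (c : V → α)
    {u v : V} (p : G.Walk u v) : Prop :=
  p.IsPath ∧ ((internalSupport p).map c).Nodup

/-- A total rainbow path: a path whose edges and internal vertices all have
pairwise distinct colors. -/
def IsTotalRainbowPath {α : Type*} {G : SimpleGraph V} (cv : V → α) (ce : Sym2 V → α)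
    {u v : V} (p : G.Walk u v) : Prop :=
  p.IsPath ∧ (p.edges.map ce ++ (internalSupport p).map cv).Nodup

/-- `G` is rainbow `k`-connected under the edge coloring `c`: any two distinct vertices are
joined by `k` pairwise internally vertex-disjoint rainbow paths. -/
def RainbowKConnected {α : Type*} (G : SimpleGraph V) (c : Sym2 V → α) (k : ℕ) : Prop :=
  ∀ u v : V, u ≠ v → ∃ P : Fin k → G.Walk u v,
    (∀ i, IsRainbowPath c (P i)) ∧ InternallyDisjoint P

/-- `G` is rainbow vertex `k`-connected under the vertex coloring `c`. -/
def VertexRainbowKConnected {α : Type*} (G : SimpleGraph V) (c : V → α) (k : ℕ) : Prop :=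
  ∀ u v : V, u ≠ v → ∃ P : Fin k → G.Walk u v,
    (∀ i, IsVertexRainbowPath c (P i)) ∧ InternallyDisjoint P

/-- The pair `u, v` is total rainbow `k`-connected under the total coloring `(cv, ce)`:
`u` and `v` are joined by `k` pairwise internally vertex-disjoint total rainbow paths. -/
def TotalRainbowKConnectedPair {α : Type*} (G : SimpleGraph V)
    (cv : V → α) (ce : Sym2 V → α) (k : ℕ) (u v : V) : Prop :=
  ∃ P : Fin k → G.Walk u v,
    (∀ i, IsTotalRainbowPath cv ce (P i)) ∧ InternallyDisjoint P

/-- `G` is total rainbow `k`-connected under the total coloring `(cv, ce)`. -/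
def TotalRainbowKConnected {α : Type*} (G : SimpleGraph V)
    (cv : V → α) (ce : Sym2 V → α) (k : ℕ) : Prop :=
  ∀ u v : V, u ≠ v → TotalRainbowKConnectedPair G cv ce k u v

/-- The rainbow `k`-connection number: the least number of colors of an edge coloring
making `G` rainbow `k`-connected. -/
noncomputable def rcK (G : SimpleGraph V) (k : ℕ) : ℕ :=
  sInf {t | ∃ c : Sym2 V → Fin t, RainbowKConnected G c k}

/-- The rainbow vertex `k`-connection number. -/
noncomputable def rvcK (G : SimpleGraph V) (k : ℕ) : ℕ :=
  sInf {t | ∃ c : V → Fin t, VertexRainbowKConnected G c k}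

/-- The total rainbow `k`-connection number. -/
noncomputable def trcK (G : SimpleGraph V) (k : ℕ) : ℕ :=
  sInf {t | ∃ (cv : V → Fin t) (ce : Sym2 V → Fin t), TotalRainbowKConnected G cv ce k}

/-- `G` is `l`-connected: it has more than `l` vertices and deleting any set of fewer than
`l` vertices leaves a connected graph. -/
def IsLConnected (G : SimpleGraph V) [Fintype V] (l : ℕ) : Prop :=
  l < Fintype.card V ∧
    ∀ S : Set V, S.ncard < l → (G.induce Sᶜ).Connected

/-- Index set for the `(k+1)²` new vertices of each added clique, viewed as
`{(i,l) : 1 ≤ i,l ≤ k+1}`. -/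
abbrev Idx (k : ℕ) := Fin (k + 1) × Fin (k + 1)

/-- Unordered pairs `{u,v}` of distinct vertices with `{u,v} ∉ P`, represented by their
increasingly ordered representative. -/
abbrev PairNotP (V : Type*) [LinearOrder V] (P : Set (Sym2 V)) : Type _ :=
  {q : V × V // q.1 < q.2 ∧ s(q.1, q.2) ∉ P}

/-- The new vertices of the reduction graph `G'`: for each `v ∈ V` a set `V_v` of `(k+1)²`
vertices, and for each pair `{u,v} ∉ P` of distinct vertices a set `V_{(u,v)}` of `(k+1)²`
vertices. -/
abbrev NewVert (V : Type*) [LinearOrder V] (P : Set (Sym2 V)) (k : ℕ) : Type _ :=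
  (V × Idx k) ⊕ (PairNotP V P × Idx k)

/-- The adjacency generating relation of the reduction graph `G'`: edges of `G`; edges
`v x` for `x ∈ V_v`; edges `u x` and `v x` for `x ∈ V_{(u,v)}`, `{u,v} ∉ P`; and all
edges between new vertices. -/
def bigRel {V : Type*} [LinearOrder V] (G : SimpleGraph V) (P : Set (Sym2 V)) (k : ℕ) :
    (V ⊕ NewVert V P k) → (V ⊕ NewVert V P k) → Prop
  | Sum.inl a, Sum.inl b => G.Adj a b
  | Sum.inl a, Sum.inr (Sum.inl (v, _)) => a = v
  | Sum.inl a, Sum.inr (Sum.inr (q, _)) => a = q.1.1 ∨ a = q.1.2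
  | Sum.inr _, Sum.inr _ => True
  | _, _ => False

/-- The reduction graph `G'` of the proof of Lemma 2.2. -/
def bigGraph {V : Type*} [LinearOrder V] (G : SimpleGraph V) (P : Set (Sym2 V)) (k : ℕ) :
    SimpleGraph (V ⊕ NewVert V P k) :=
  SimpleGraph.fromRel (bigRel G P k)

section Paths

variable {α W : Type*} {G : SimpleGraph V} {H : SimpleGraph W} {k : ℕ}

theorem internalSupport_reverse {u v : V} (p : G.Walk u v) :
    internalSupport p.reverse = (internalSupport p).reverse := by
  simp [internalSupport, List.tail_reverse, List.dropLast_reverse, List.tail_dropLast]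

theorem internalSupport_map (f : G →g H) {u v : V} (p : G.Walk u v) :
    internalSupport (p.map f) = (internalSupport p).map f := by
  simp [internalSupport, List.map_dropLast]

theorem IsTotalRainbowPath.reverse {cv : V → α} {ce : Sym2 V → α} {u v : V} {p : G.Walk u v}
    (hp : IsTotalRainbowPath cv ce p) : IsTotalRainbowPath cv ce p.reverse := by
  refine ⟨hp.1.reverse, ?_⟩
  rw [internalSupport_reverse, Walk.edges_reverse, List.map_reverse, List.map_reverse]
  exact (((List.reverse_perm _).append (List.reverse_perm _)).nodup_iff).2 hp.2

theorem TotalRainbowKConnectedPair.symm {cv : V → α} {ce : Sym2 V → α} {u v : V}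
    (h : TotalRainbowKConnectedPair G cv ce k u v) :
    TotalRainbowKConnectedPair G cv ce k v u := by
  obtain ⟨p, hp, hinj, hdisj⟩ := h
  refine ⟨fun i => (p i).reverse, fun i => (hp i).reverse,
    fun i j hij => hinj (Walk.reverse_injective hij), fun i j hij w hi => ?_⟩
  rw [internalSupport_reverse, List.mem_reverse] at hi ⊢
  exact hdisj i j hij w hi

/-- Total rainbow `k`-connectedness of a pair is preserved by color-preserving embeddings. -/
theorem TotalRainbowKConnectedPair.map {cv : V → α} {ce : Sym2 V → α} {cv' : W → α}
    {ce' : Sym2 W → α} (f : G →g H) (hf : Function.Injective f) (hcv : ∀ v, cv' (f v) = cv v)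
    (hce : ∀ a b, G.Adj a b → ce' s(f a, f b) = ce s(a, b)) {u v : V}
    (h : TotalRainbowKConnectedPair G cv ce k u v) :
    TotalRainbowKConnectedPair H cv' ce' k (f u) (f v) := by
  obtain ⟨p, hp, hinj, hdisj⟩ := h
  refine ⟨fun i => (p i).map f, fun i => ⟨(hp i).1.map hf, ?_⟩,
    fun i j hij => hinj (Walk.map_injective_of_injective hf _ _ hij), fun i j hij w hi => ?_⟩
  · have hedges : (p i).edges.map (ce' ∘ Sym2.map f) = (p i).edges.map ce := by
      refine List.map_congr_left fun e he => ?_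
      induction e with
      | _ a b => exact hce a b ((p i).adj_of_mem_edges he)
    have hverts : cv' ∘ f = cv := funext hcv
    rw [internalSupport_map, Walk.edges_map, List.map_map, List.map_map, hedges, hverts]
    exact (hp i).2
  · rw [internalSupport_map, List.mem_map] at hi ⊢
    rintro ⟨b, hb, hbw⟩
    obtain ⟨a, ha, haw⟩ := hi
    obtain rfl := hf (haw.trans hbw.symm)
    exact hdisj i j hij a ha hb

/-- A pair is total rainbow `k`-connected as soon as it is joined by `k` total rainbow paths of
length at most two; the value `f i = v` stands for the single edge `uv`, any other value is the
middle vertex of the `i`-th path. -/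
theorem TotalRainbowKConnectedPair.of_length_le_two {cv : V → α} {ce : Sym2 V → α} {u v : V}
    (huv : u ≠ v) (f : Fin k → V) (hf : Function.Injective f)
    (h : ∀ i, (f i = v ∧ G.Adj u v) ∨ (G.Adj u (f i) ∧ G.Adj (f i) v ∧
      [ce s(u, f i), ce s(f i, v), cv (f i)].Nodup)) :
    TotalRainbowKConnectedPair G cv ce k u v := by
  have key : ∀ i, ∃ p : G.Walk u v, IsTotalRainbowPath cv ce p ∧
      (internalSupport p = [f i] ∨ internalSupport p = [] ∧ f i = v) := by
    intro i
    rcases h i with ⟨hi, huv'⟩ | ⟨h₁, h₂, hc⟩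
    · exact ⟨huv'.toWalk, ⟨by simp [huv], by simp [internalSupport]⟩,
        Or.inr ⟨by simp [internalSupport], hi⟩⟩
    · refine ⟨Walk.cons h₁ (Walk.cons h₂ Walk.nil), ⟨?_, ?_⟩, Or.inl ?_⟩
      · simp [Walk.cons_isPath_iff, h₁.ne, h₂.ne, huv]
      · simpa [internalSupport] using hc
      · simp [internalSupport]
  choose p hp hint using key
  have hmem : ∀ i w, w ∈ internalSupport (p i) → w = f i := by
    intro i w hw
    rcases hint i with h | ⟨h, -⟩ <;> rw [h] at hw
    · exact List.mem_singleton.1 hw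
    · exact absurd hw List.not_mem_nil
  refine ⟨p, hp, fun i j hij => hf ?_, fun i j hij w hi hj => hij (hf ?_)⟩
  · rcases hint i with hi | ⟨hi, hiv⟩ <;> rcases hint j with hj | ⟨hj, hjv⟩ <;>
      rw [hij, hj] at hi
    · simpa using hi.symm
    · simp at hi
    · simp at hi
    · rw [hiv, hjv]
  · rw [← hmem i w hi, ← hmem j w hj]

/-- Two vertices of a clique indexed by `Idx k`, with an edge colored `a` if its endpoints agree
in a coordinate and `b` otherwise, are total rainbow `k`-connected. -/
theorem TotalRainbowKConnectedPair.of_grid_clique {cv : V → α} {ce : Sym2 V → α} {a b c : α}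
    (hcol : [a, b, c].Nodup) (g : Idx k → V) (hg : Function.Injective g)
    (hadj : ∀ i j, i ≠ j → G.Adj (g i) (g j)) (hcv : ∀ i, cv (g i) = c)
    (hce : ∀ i j, i ≠ j → ce s(g i, g j) = if i.1 = j.1 ∨ i.2 = j.2 then a else b)
    {i j : Idx k} (hij : i ≠ j) : TotalRainbowKConnectedPair G cv ce k (g i) (g j) := by
  have detour : ∀ m : Idx k, (i.1 = m.1 ∨ i.2 = m.2) → i ≠ m → m.1 ≠ j.1 → m.2 ≠ j.2 →
      G.Adj (g i) (g m) ∧ G.Adj (g m) (g j) ∧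
        [ce s(g i, g m), ce s(g m, g j), cv (g m)].Nodup := by
    intro m him hne h₁ h₂
    have hmj : m ≠ j := fun h => h₁ (congrArg Prod.fst h)
    refine ⟨hadj _ _ hne, hadj _ _ hmj, ?_⟩
    rw [hce _ _ hne, hce _ _ hmj, hcv, if_pos him, if_neg (by tauto)]
    exact hcol
  obtain ⟨i₁, i₂⟩ := i
  obtain ⟨j₁, j₂⟩ := j
  by_cases h₁ : i₁ = j₁
  · subst h₁
    have h₂ : i₂ ≠ j₂ := fun h => hij (by rw [h])
    refine .of_length_le_two (hg.ne hij) (fun m => g (i₁.succAbove m, i₂))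
      (fun m n hmn => ?_) (fun m => Or.inr (detour _ (Or.inr rfl) ?_ ?_ h₂))
    · simpa using hg hmn
    · simp [(Fin.succAbove_ne i₁ m).symm]
    · exact Fin.succAbove_ne i₁ m
  by_cases h₂ : i₂ = j₂
  · subst h₂
    refine .of_length_le_two (hg.ne hij) (fun m => g (i₁, i₂.succAbove m))
      (fun m n hmn => ?_) (fun m => Or.inr (detour _ (Or.inl rfl) ?_ h₁ ?_))
    · simpa using hg hmn
    · simp [(Fin.succAbove_ne i₂ m).symm]
    · exact Fin.succAbove_ne i₂ m
  · refine .of_length_le_two (hg.ne hij)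
      (fun m => g (if i₂.succAbove m = j₂ then j₁ else i₁, i₂.succAbove m))
      (fun m n hmn => ?_) (fun m => ?_)
    · have := congrArg Prod.snd (hg hmn)
      simpa using this
    · by_cases hm : i₂.succAbove m = j₂
      · exact Or.inl ⟨by simp [hm], hadj _ _ hij⟩
      · refine Or.inr ?_
        rw [if_neg hm]
        exact detour _ (Or.inl rfl) (by simp [(Fin.succAbove_ne i₂ m).symm]) h₁ hm

end Paths

section BigGraph

variable [LinearOrder V] {G : SimpleGraph V} {P : Set (Sym2 V)} {k : ℕ}

/-- The new vertex with index `i` in the clique `V_v` or `V_{(u,v)}`. -/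
def newVertex (P : Set (Sym2 V)) (c : V ⊕ PairNotP V P) (i : Idx k) : V ⊕ NewVert V P k :=
  Sum.inr (c.map (fun v => (v, i)) (fun q => (q, i)))

theorem exists_eq_newVertex (w : NewVert V P k) :
    ∃ (c : V ⊕ PairNotP V P) (i : Idx k), newVertex P c i = Sum.inr w := by
  rcases w with ⟨v, i⟩ | ⟨q, i⟩
  · exact ⟨Sum.inl v, i, rfl⟩
  · exact ⟨Sum.inr q, i, rfl⟩

theorem newVertex_inj {c d : V ⊕ PairNotP V P} {i j : Idx k} :
    newVertex P c i = newVertex P d j ↔ c = d ∧ i = j := by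
  rcases c with c | c <;> rcases d with d | d <;>
    simp only [newVertex, Sum.map_inl, Sum.map_inr, Sum.inr.injEq, Sum.inl.injEq, Prod.mk.injEq,
      reduceCtorEq, false_and]

theorem newVertex_injective (c : V ⊕ PairNotP V P) :
    Function.Injective (newVertex (k := k) P c) :=
  fun _ _ h => (newVertex_inj.1 h).2

theorem bigGraph_adj_inl {a b : V} (h : G.Adj a b) :
    (bigGraph G P k).Adj (Sum.inl a) (Sum.inl b) :=
  ⟨by simpa using h.ne, Or.inl h⟩

theorem bigGraph_adj_vertexClique (a : V) (i : Idx k) :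
    (bigGraph G P k).Adj (Sum.inl a) (newVertex P (Sum.inl a) i) :=
  ⟨by simp [newVertex], Or.inl rfl⟩

theorem bigGraph_adj_pairClique (q : PairNotP V P) {a : V} (ha : a = q.1.1 ∨ a = q.1.2)
    (i : Idx k) : (bigGraph G P k).Adj (Sum.inl a) (newVertex P (Sum.inr q) i) :=
  ⟨by simp [newVertex], Or.inl ha⟩

theorem bigGraph_adj_newVertex {c d : V ⊕ PairNotP V P} {i j : Idx k}
    (h : newVertex P c i ≠ newVertex P d j) :
    (bigGraph G P k).Adj (newVertex P c i) (newVertex P d j) :=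
  ⟨h, Or.inl trivial⟩

end BigGraph

/-- Suppose the total coloring `(cv, ce)` of `G` with colors `{0,1,2}`
makes every pair in `P` total rainbow `k`-connected. Extend it to a total coloring
`(cv', ce')` of `G'` as in Lemma 2.2: all new vertices get color `2`; the edges `v x`,
`x ∈ V_v`, get color `1`; the edges `u x` get color `0` and `v x` color `1` for
`x ∈ V_{(u,v)}`, `{u,v} ∉ P` (with `u < v`); inside each clique `V_v` and `V_{(u,v)}`
(on vertex set `{(i,l) : 1 ≤ i,l ≤ k+1}`) an edge gets color `0` if its endpoints agree in
the first or second coordinate and color `1` otherwise; and all remaining (cross-clique)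
edges get color `0`. Then `(cv', ce')` makes every two distinct vertices of `G'` total
rainbow `k`-connected. -/
theorem bigGraph_trc3_extension {V : Type*} [LinearOrder V] (k : ℕ) (hk : 1 ≤ k)
    (G : SimpleGraph V) (hG : G.Connected) (P : Set (Sym2 V))
    (hP : ∀ u v : V, s(u, v) ∈ P → u ≠ v ∧ ¬G.Adj u v)
    (cv : V → Fin 3) (ce : Sym2 V → Fin 3)
    (hχ : ∀ u v : V, s(u, v) ∈ P → TotalRainbowKConnectedPair G cv ce k u v)
    (cv' : (V ⊕ NewVert V P k) → Fin 3) (ce' : Sym2 (V ⊕ NewVert V P k) → Fin 3)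
    -- `cv'` extends `cv` and colors all new vertices `2`:
    (hcv₁ : ∀ v : V, cv' (Sum.inl v) = cv v)
    (hcv₂ : ∀ w : NewVert V P k, cv' (Sum.inr w) = 2)
    -- `ce'` extends `ce` on the edges of `G`:
    (hceG : ∀ a b : V, G.Adj a b → ce' s(Sum.inl a, Sum.inl b) = ce s(a, b))
    -- edges `v x_{(v,i)}` get color `1`:
    (hVv : ∀ (v : V) (i : Idx k),
      ce' s(Sum.inl v, Sum.inr (Sum.inl (v, i))) = 1)
    -- edges `u x_{(u,v,i)}` get color `0`, edges `v x_{(u,v,i)}` get color `1`: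
    (hUV₀ : ∀ (q : PairNotP V P) (i : Idx k),
      ce' s(Sum.inl q.1.1, Sum.inr (Sum.inr (q, i))) = 0)
    (hUV₁ : ∀ (q : PairNotP V P) (i : Idx k),
      ce' s(Sum.inl q.1.2, Sum.inr (Sum.inr (q, i))) = 1)
    -- the cliques `G'[V_v]` and `G'[V_{(u,v)}]` are colored as in Lemma 2.1:
    (hclV : ∀ (v : V) (i j : Idx k), i ≠ j →
      ce' s(Sum.inr (Sum.inl (v, i)), Sum.inr (Sum.inl (v, j))) =
        if i.1 = j.1 ∨ i.2 = j.2 then 0 else 1)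
    (hclP : ∀ (q : PairNotP V P) (i j : Idx k), i ≠ j →
      ce' s(Sum.inr (Sum.inr (q, i)), Sum.inr (Sum.inr (q, j))) =
        if i.1 = j.1 ∨ i.2 = j.2 then 0 else 1)
    -- all remaining (cross-clique) edges get color `0`:
    (hcr₁ : ∀ (v v' : V) (i j : Idx k), v ≠ v' →
      ce' s(Sum.inr (Sum.inl (v, i)), Sum.inr (Sum.inl (v', j))) = 0)
    (hcr₂ : ∀ (v : V) (q : PairNotP V P) (i j : Idx k),
      ce' s(Sum.inr (Sum.inl (v, i)), Sum.inr (Sum.inr (q, j))) = 0)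
    (hcr₃ : ∀ (q q' : PairNotP V P) (i j : Idx k), q ≠ q' →
      ce' s(Sum.inr (Sum.inr (q, i)), Sum.inr (Sum.inr (q', j))) = 0) :
    TotalRainbowKConnected (bigGraph G P k) cv' ce' k := by
  have hclique : ∀ (c : V ⊕ PairNotP V P) (i j : Idx k), i ≠ j →
      ce' s(newVertex P c i, newVertex P c j) = if i.1 = j.1 ∨ i.2 = j.2 then 0 else 1 := by
    rintro (v | q) i j hij
    exacts [hclV v i j hij, hclP q i j hij]
  have hcross : ∀ (c d : V ⊕ PairNotP V P) (i j : Idx k), c ≠ d →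
      ce' s(newVertex P c i, newVertex P d j) = 0 := by
    rintro (v | q) (v' | q') i j hcd
    · exact hcr₁ v v' i j fun h => hcd (congrArg _ h)
    · exact hcr₂ v q' i j
    · rw [Sym2.eq_swap]
      exact hcr₂ v' q j i
    · exact hcr₃ q q' i j fun h => hcd (congrArg _ h)
  have hnew : ∀ (c : V ⊕ PairNotP V P) (i : Idx k), cv' (newVertex P c i) = 2 :=
    fun c i => hcv₂ _
  have hold_lt : ∀ a b : V, a < b →
      TotalRainbowKConnectedPair (bigGraph G P k) cv' ce' k (Sum.inl a) (Sum.inl b) := by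
    intro a b hab
    by_cases hmem : s(a, b) ∈ P
    · exact (hχ a b hmem).map ⟨Sum.inl, bigGraph_adj_inl⟩ Sum.inl_injective hcv₁ hceG
    · let q : PairNotP V P := ⟨(a, b), hab, hmem⟩
      refine .of_length_le_two (by simpa using hab.ne)
        (fun m => newVertex P (Sum.inr q) (m.castSucc, 0))
        (fun m n hmn => by simpa using newVertex_injective _ hmn) (fun m => Or.inr
          ⟨bigGraph_adj_pairClique q (Or.inl rfl) _,
            (bigGraph_adj_pairClique q (Or.inr rfl) _).symm, ?_⟩)
      rw [hnew, Sym2.eq_swap (a := newVertex P (Sum.inr q) _)]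
      have h₀ : ce' s(Sum.inl a, newVertex P (Sum.inr q) (m.castSucc, 0)) = 0 := hUV₀ q _
      have h₁ : ce' s(Sum.inl b, newVertex P (Sum.inr q) (m.castSucc, 0)) = 1 := hUV₁ q _
      rw [h₀, h₁]
      decide
  have hold_new : ∀ (a : V) (c : V ⊕ PairNotP V P) (j : Idx k),
      TotalRainbowKConnectedPair (bigGraph G P k) cv' ce' k (Sum.inl a) (newVertex P c j) := by
    intro a c j
    have hne : ∀ m : Fin k, newVertex P (Sum.inl a) (j.1, j.2.succAbove m) ≠ newVertex P c j :=
      fun m h => Fin.succAbove_ne j.2 m (congrArg Prod.snd (newVertex_inj.1 h).2)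
    refine .of_length_le_two (by simp [newVertex])
      (fun m => newVertex P (Sum.inl a) (j.1, j.2.succAbove m))
      (fun m n hmn => by simpa using newVertex_injective _ hmn) (fun m => Or.inr
        ⟨bigGraph_adj_vertexClique a _, bigGraph_adj_newVertex (hne m), ?_⟩)
    have h₁ : ce' s(Sum.inl a, newVertex P (Sum.inl a) (j.1, j.2.succAbove m)) = 1 := hVv a _
    have h₀ : ce' s(newVertex P (Sum.inl a) (j.1, j.2.succAbove m), newVertex P c j) = 0 := by
      by_cases hc : Sum.inl a = c
      · subst hc
        rw [hclique _ _ _ fun h => hne m (by rw [h]), if_pos (Or.inl rfl)]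
      · exact hcross _ _ _ _ hc
    rw [hnew, h₁, h₀]
    decide
  have hnew_new : ∀ (c d : V ⊕ PairNotP V P) (i j : Idx k), newVertex P c i ≠ newVertex P d j →
      TotalRainbowKConnectedPair (bigGraph G P k) cv' ce' k
        (newVertex P c i) (newVertex P d j) := by
    intro c d i j hne
    by_cases hcd : c = d
    · subst hcd
      exact .of_grid_clique (a := 0) (b := 1) (c := 2) (by decide) (newVertex P c)
        (newVertex_injective c)
        (fun i j hij => bigGraph_adj_newVertex ((newVertex_injective c).ne hij)) (hnew c)
        (hclique c) (fun h => hne (by rw [h]))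
    · have hi : ∀ m : Fin k, i ≠ (i.1.succAbove m, i.2.succAbove m) :=
        fun m h => Fin.succAbove_ne i.1 m (congrArg Prod.fst h).symm
      refine .of_length_le_two hne
        (fun m => newVertex P c (i.1.succAbove m, i.2.succAbove m))
        (fun m n hmn => by simpa using newVertex_injective _ hmn) (fun m => Or.inr
          ⟨bigGraph_adj_newVertex ((newVertex_injective c).ne (hi m)),
            bigGraph_adj_newVertex fun h => hcd (newVertex_inj.1 h).1, ?_⟩)
      rw [hnew, hcross _ _ _ _ hcd, hclique _ _ _ (hi m), if_neg (by
        simp [(Fin.succAbove_ne _ m).symm])]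
      decide
  rintro (a | w) (b | z) huv
  · rcases lt_or_gt_of_ne fun h : a = b => huv (congrArg _ h) with hab | hab
    exacts [hold_lt a b hab, (hold_lt b a hab).symm]
  · obtain ⟨c, i, hz⟩ := exists_eq_newVertex z
    rw [← hz]
    exact hold_new a c i
  · obtain ⟨c, i, hw⟩ := exists_eq_newVertex w
    rw [← hw]
    exact (hold_new b c i).symm
  · obtain ⟨c, i, hw⟩ := exists_eq_newVertex w
    obtain ⟨d, j, hz⟩ := exists_eq_newVertex z
    rw [← hw, ← hz] at huv ⊢
    exact hnew_new c d i j huv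

end Paper
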